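/- arXiv:1808.01800 — 2 statements merged into one kernel-verified Lean document; each statement's English description precedes it below -/
import Mathlib

section
/- Let G be a graph represented by a k-uniform word w. Then for every i with 1 ≤ i ≤ k, the (k+1)-uniform word p_{{i}}(w) w (the concatenation of the word keeping only the i-th occurrence of each letter, followed by w) also represents G. -/
open SimpleGraph

variable {V V' : Type*}

/-- Two letters `x` and `y` alternate in the word `w` if the word obtained from `w` by
deleting all letters other than `x` and `y` has no two consecutive equal letters. -/
def alternate [DecidableEq V] (w : List V) (x y : V) : Prop :=
  (w.filter (fun z => decide (z = x ∨ z = y))).Chain' (· ≠ ·)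

/-- A word `w` over the alphabet `V` represents the graph `G`: every letter of the
alphabet occurs in `w`, and two distinct letters alternate in `w` iff they are
adjacent in `G`. -/
def represents [DecidableEq V] (G : SimpleGraph V) (w : List V) : Prop :=
  (∀ x : V, x ∈ w) ∧ ∀ x y : V, x ≠ y → (alternate w x y ↔ G.Adj x y)

/-- A word is `k`-uniform if every letter of the alphabet occurs exactly `k` times. -/
def uniform [DecidableEq V] (k : ℕ) (w : List V) : Prop :=
  ∀ x : V, w.count x = k

/-- Label each letter with its occurrence number (`1`-based): the `i`th occurrence
of the letter `x` in `w` becomes the pair `(x, i)`. -/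
def labelAux [DecidableEq V] (c : V → ℕ) : List V → List (V × ℕ)
  | [] => []
  | x :: xs => (x, c x + 1) :: labelAux (Function.update c x (c x + 1)) xs

/-- The labelled version of a word. -/
def label [DecidableEq V] (w : List V) : List (V × ℕ) := labelAux (fun _ => 0) w

/-- `pA A w` keeps, for each letter `x`, exactly the `i`th occurrences of `x` for
`i ∈ A`, and deletes all other occurrences. -/
def pA [DecidableEq V] (A : Finset ℕ) (w : List V) : List V :=
  ((label w).filter (fun p => decide (p.2 ∈ A))).map Prod.fst

/-- Applying an occurrence-based function `h` to a word `w`: the `i`th occurrence of a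
letter `x` in `w` is replaced by the string `h x i`. -/
def obf [DecidableEq V] (h : V → ℕ → List V') (w : List V) : List V' :=
  (label w).flatMap (fun p => h p.1 p.2)

lemma filter_labelAux [DecidableEq V] (p : V → Bool) (w : List V) (c c' : V → ℕ)
    (h : ∀ z, p z = true → c z = c' z) :
    (labelAux c w).filter (fun q => p q.1) = labelAux c' (w.filter p) := by
  induction w generalizing c c' with
  | nil => rfl
  | cons a w ih =>
    by_cases ha : p a = true
    · simp only [labelAux, List.filter_cons, ha, if_true, h a ha]
      congr 1
      apply ih
      intro z hz
      by_cases hza : z = a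
      · subst hza; simp
      · simp [hza, h z hz]
    · simp only [labelAux, List.filter_cons, ha]
      apply ih
      intro z hz
      have hza : z ≠ a := by rintro rfl; exact ha hz
      simp [hza, h z hz]

lemma filter_pA [DecidableEq V] (A : Finset ℕ) (p : V → Bool) (w : List V) :
    (pA A w).filter p = pA A (w.filter p) := by
  unfold pA label
  rw [← filter_labelAux p w (fun _ => 0) (fun _ => 0) (fun _ _ => rfl), List.filter_map,
    List.filter_filter, List.filter_filter]
  simp only [Function.comp_def, Bool.and_comm]

lemma count_filter_labelAux [DecidableEq V] (i : ℕ) (x : V) (w : List V) (c : V → ℕ) :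
    (((labelAux c w).filter (fun p => decide (p.2 ∈ ({i} : Finset ℕ)))).map Prod.fst).count x
      = if c x < i ∧ i ≤ c x + w.count x then 1 else 0 := by
  induction w generalizing c with
  | nil => simp [labelAux]
  | cons a w ih =>
    have := ih (Function.update c a (c a + 1))
    by_cases hax : a = x
    · subst hax
      by_cases hi : c a + 1 = i <;>
        simp [labelAux, hi] at this ⊢ <;> grind
    · by_cases hi : c a + 1 = i <;>
        simp [labelAux, hi, hax, Ne.symm hax] at this ⊢ <;> grind

lemma count_pA_singleton [DecidableEq V] {i : ℕ} {x : V} {w : List V}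
    (hi1 : 1 ≤ i) (hi : i ≤ w.count x) : (pA {i} w).count x = 1 := by
  unfold pA label
  rw [count_filter_labelAux, if_pos]
  simp only [zero_add]
  exact ⟨hi1, hi⟩

/-- The word `xyxy⋯xy` with `k` occurrences of each of `x` and `y`. -/
def alternatingWord (x y : V) : ℕ → List V
  | 0 => []
  | k + 1 => x :: y :: alternatingWord x y k

lemma isChain_alternatingWord {x y : V} (hxy : x ≠ y) (k : ℕ) :
    (alternatingWord x y k).IsChain (· ≠ ·) := by
  induction k with
  | zero => simp [alternatingWord]
  | succ k ih =>
    cases k with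
    | zero => simp [alternatingWord, hxy]
    | succ k =>
      simp only [alternatingWord, List.isChain_cons_cons] at ih ⊢
      exact ⟨hxy, hxy.symm, ih⟩

lemma eq_alternatingWord [DecidableEq V] {x y : V} (hxy : x ≠ y) (k : ℕ) (u : List V)
    (hmem : ∀ z ∈ u, z = x ∨ z = y) (hchain : u.IsChain (· ≠ ·)) (hx : u.count x = k)
    (hy : u.count y = k) (hhead : u.head? ≠ some y) : u = alternatingWord x y k := by
  induction k generalizing u with
  | zero =>
    rw [List.count_eq_zero] at hx hy
    cases u with
    | nil => rfl
    | cons a u =>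
      rcases hmem a (by simp) with rfl | rfl <;> simp at hx hy
  | succ k ih =>
    match u, hmem, hchain, hx, hy, hhead with
    | [], _, _, hx, _, _ => simp at hx
    | [a], hmem, _, hx, hy, _ =>
      rcases hmem a (by simp) with rfl | rfl
      · simp [hxy] at hy
      · simp [hxy.symm] at hx
    | a :: b :: u, hmem, hchain, hx, hy, hhead =>
      have ha : a = x := (hmem a (by simp)).resolve_right (by simpa using hhead)
      subst ha
      rw [List.isChain_cons_cons] at hchain
      have hb : b = y := (hmem b (by simp)).resolve_left hchain.1.symm
      subst hb
      rw [alternatingWord, ← ih u (fun z hz => hmem z (by simp [hz])) hchain.2.tail]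
      · simpa [hxy.symm] using hx
      · simpa [hxy] using hy
      · intro h
        cases u with
        | nil => simp at h
        | cons d u => simp at h; simp [h] at hchain

lemma filter_labelAux_alternatingWord [DecidableEq V] {x y : V} (hxy : x ≠ y) (i k m : ℕ)
    (c : V → ℕ) (hx : c x = m) (hy : c y = m) :
    ((labelAux c (alternatingWord x y k)).filter
      (fun p => decide (p.2 ∈ ({i} : Finset ℕ)))).map Prod.fst
      = if m < i ∧ i ≤ m + k then [x, y] else [] := by
  induction k generalizing c m with
  | zero => simp [alternatingWord, labelAux]
  | succ k ih =>
    have := ih (m + 1) (Function.update (Function.update c x (m + 1)) y (m + 1))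
      (by simp [hxy]) (by simp)
    by_cases hi : m + 1 = i
    · rw [if_neg (by omega)] at this
      subst hi
      simp only [alternatingWord, labelAux, hx, hy, Function.update_of_ne hxy.symm,
        Finset.mem_singleton, decide_true, List.filter_cons_of_pos, List.map_cons] at this ⊢
      rw [this, if_pos (by omega)]
    · have hiff : m < i ∧ i ≤ m + (k + 1) ↔ m + 1 < i ∧ i ≤ m + 1 + k := by omega
      simp only [hiff, ← this]
      simp [alternatingWord, labelAux, hx, hy, hxy.symm, hi]

lemma pA_singleton_alternatingWord [DecidableEq V] {x y : V} (hxy : x ≠ y) {i k : ℕ}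
    (hi1 : 1 ≤ i) (hik : i ≤ k) : pA {i} (alternatingWord x y k) = [x, y] := by
  unfold pA label
  rw [filter_labelAux_alternatingWord hxy i k 0 _ rfl rfl, if_pos]
  simp only [zero_add]
  exact ⟨hi1, hik⟩

lemma isChain_pA_singleton_append [DecidableEq V] {x y : V} (hxy : x ≠ y) {i k : ℕ} {u : List V}
    (hi1 : 1 ≤ i) (hik : i ≤ k) (hmem : ∀ z ∈ u, z = x ∨ z = y) (hchain : u.IsChain (· ≠ ·))
    (hx : u.count x = k) (hy : u.count y = k) : (pA {i} u ++ u).IsChain (· ≠ ·) := by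
  by_cases hhead : u.head? = some y
  · rw [eq_alternatingWord hxy.symm k u (fun z hz => (hmem z hz).symm) hchain hy hx
      (by simpa [hhead] using hxy.symm), pA_singleton_alternatingWord hxy.symm hi1 hik]
    exact isChain_alternatingWord hxy.symm (k + 1)
  · rw [eq_alternatingWord hxy k u hmem hchain hx hy hhead,
      pA_singleton_alternatingWord hxy hi1 hik]
    exact isChain_alternatingWord hxy (k + 1)

lemma alternate_pA_singleton_append [DecidableEq V] {x y : V} (hxy : x ≠ y) {i k : ℕ} {w : List V}
    (hi1 : 1 ≤ i) (hik : i ≤ k) (hw : uniform k w) :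
    alternate (pA {i} w ++ w) x y ↔ alternate w x y := by
  unfold alternate
  rw [List.filter_append, filter_pA]
  refine ⟨fun h => (List.isChain_append.1 h).2.1, fun h => ?_⟩
  refine isChain_pA_singleton_append hxy hi1 hik (fun z hz => ?_) h ?_ ?_
  · simpa using (List.mem_filter.1 hz).2
  · rw [List.count_filter (by simp), hw]
  · rw [List.count_filter (by simp), hw]

theorem stmt2 {V : Type*} [DecidableEq V] (G : SimpleGraph V) (k : ℕ) (w : List V)
    (hw : uniform k w) (hrep : represents G w) (i : ℕ) (hi1 : 1 ≤ i) (hik : i ≤ k) :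
    uniform (k + 1) (pA {i} w ++ w) ∧ represents G (pA {i} w ++ w) := by
  refine ⟨fun x => ?_, fun x => List.mem_append_right _ (hrep.1 x), fun x y hxy => ?_⟩
  · rw [List.count_append, count_pA_singleton hi1 (by rw [hw]; exact hik), hw, add_comm]
  · rw [alternate_pA_singleton_append hxy hi1 hik hw, hrep.2 x y hxy]
end

section
/- If a graph G is k-representable for some k > 1, then the Cartesian product G □ K_2 is (k+1)-representable. -/
open SimpleGraph

variable {V V' : Type*}

theorem labelAux_concat [DecidableEq V] (c : V → ℕ) (w : List V) (a : V) :
    labelAux c (w ++ [a]) = labelAux c w ++ [(a, c a + w.count a + 1)] := by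
  induction w generalizing c with
  | nil => simp [labelAux]
  | cons b w ih =>
    simp only [List.cons_append, labelAux, ih, List.count_cons]
    by_cases h : b = a
    · subst h
      simp [Nat.add_comm, Nat.add_left_comm]
    · simp [h, Function.update_of_ne (Ne.symm h)]

theorem obf_nil [DecidableEq V] (h : V → ℕ → List V') : obf h [] = [] := rfl

theorem obf_concat [DecidableEq V] (h : V → ℕ → List V') (w : List V) (a : V) :
    obf h (w ++ [a]) = obf h w ++ h a (w.count a + 1) := by
  simp [obf, label, labelAux_concat]

theorem obf_append_prefix [DecidableEq V] (h : V → ℕ → List V') (w v : List V) :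
    obf h w <+: obf h (w ++ v) := by
  induction v using List.reverseRecOn with
  | nil => simp
  | append_singleton v a ih =>
    rw [← List.append_assoc, obf_concat]
    exact ih.trans (List.prefix_append _ _)

theorem obf_prefix_obf [DecidableEq V] (h : V → ℕ → List V') {q w : List V} (hq : q <+: w) :
    obf h q <+: obf h w := by
  obtain ⟨v, rfl⟩ := hq
  exact obf_append_prefix h q v

theorem prefix_append_cases {p l l' : List V} (h : p <+: l ++ l') :
    p <+: l ∨ ∃ q, q <+: l' ∧ p = l ++ q := by
  rcases List.prefix_or_prefix_of_prefix h (List.prefix_append l l') with h1 | ⟨q, rfl⟩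
  · exact Or.inl h1
  · exact Or.inr ⟨q, (List.prefix_append_right_inj l).1 h, rfl⟩

/-- The letters `x` and `y` alternate in `w`, with `x` coming first, expressed by counting
occurrences in the prefixes of `w`. -/
def Leads [DecidableEq V] (w : List V) (x y : V) : Prop :=
  ∀ p, p <+: w → p.count y ≤ p.count x ∧ p.count x ≤ p.count y + 1

theorem leads_nil [DecidableEq V] (x y : V) : Leads [] x y := by
  intro p hp
  simp [List.prefix_nil.1 hp]

theorem leads_cons_first [DecidableEq V] {x y : V} (hxy : x ≠ y) (l : List V) :
    Leads (x :: l) x y ↔ Leads l y x := by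
  constructor
  · intro h p hp
    have := h (x :: p) (by simpa using hp)
    simp only [List.count_cons_self, List.count_cons_of_ne hxy] at this
    omega
  · intro h p hp
    rcases List.prefix_cons_iff.1 hp with rfl | ⟨q, rfl, hq⟩
    · simp
    · have := h q hq
      simp only [List.count_cons_self, List.count_cons_of_ne hxy]
      omega

theorem not_leads_cons_second [DecidableEq V] {x y : V} (hxy : x ≠ y) (l : List V) :
    ¬ Leads (y :: l) x y := by
  intro h
  have := (h [y] (by simp)).1
  simp [hxy.symm] at this

theorem leads_cons_of_ne [DecidableEq V] {x y z : V} (hx : z ≠ x) (hy : z ≠ y) (l : List V) :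
    Leads (z :: l) x y ↔ Leads l x y := by
  constructor
  · intro h p hp
    have := h (z :: p) (by simpa using hp)
    simpa only [List.count_cons_of_ne hx, List.count_cons_of_ne hy] using this
  · intro h p hp
    rcases List.prefix_cons_iff.1 hp with rfl | ⟨q, rfl, hq⟩
    · simp
    · simpa only [List.count_cons_of_ne hx, List.count_cons_of_ne hy] using h q hq

theorem isChain_cons_filter_iff_leads [DecidableEq V] {x y : V} (hxy : x ≠ y) (l : List V) :
    (x :: l.filter (fun z => decide (z = x ∨ z = y))).IsChain (· ≠ ·) ↔ Leads l y x := by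
  induction l generalizing x y with
  | nil => simp [leads_nil]
  | cons a l ih =>
    by_cases hx : a = x
    · subst hx
      simp [not_leads_cons_second hxy.symm]
    by_cases hy : a = y
    · subst hy
      rw [leads_cons_first hxy.symm, ← ih hxy.symm]
      simp [hxy, or_comm]
    · rw [leads_cons_of_ne hy hx, ← ih hxy]
      simp [hx, hy]

theorem alternate_iff_isChain [DecidableEq V] (l : List V) (x y : V) :
    alternate l x y ↔ (l.filter (fun z => decide (z = x ∨ z = y))).IsChain (· ≠ ·) :=
  Iff.rfl

theorem alternate_iff_leads [DecidableEq V] {x y : V} (hxy : x ≠ y) (l : List V) :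
    alternate l x y ↔ Leads l x y ∨ Leads l y x := by
  induction l with
  | nil => simp [alternate_iff_isChain, leads_nil]
  | cons a l ih =>
    by_cases hx : a = x
    · subst hx
      rw [leads_cons_first hxy, ← isChain_cons_filter_iff_leads hxy l]
      simp [alternate_iff_isChain, not_leads_cons_second hxy.symm]
    by_cases hy : a = y
    · subst hy
      rw [leads_cons_first hxy.symm, ← isChain_cons_filter_iff_leads hxy.symm l]
      simp [alternate_iff_isChain, not_leads_cons_second hxy, or_comm]
    · rw [leads_cons_of_ne hy hx, leads_cons_of_ne hx hy, ← ih]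
      simp [alternate_iff_isChain, hx, hy]

/-- Each occurrence of `x` becomes `(x, 0) (x, 1)`, but from the `k`th on only `(x, 0)`. -/
def frontBlock (k : ℕ) (x : V) (i : ℕ) : List (V × Fin 2) :=
  if i < k then [(x, 0), (x, 1)] else [(x, 0)]

/-- The occurrence `k - 1` of `x` becomes `(x, 1) (x, 0)`, later ones become `(x, 1)`, and
earlier ones are deleted. -/
def backBlock (k : ℕ) (x : V) (i : ℕ) : List (V × Fin 2) :=
  if i + 1 = k then [(x, 1), (x, 0)] else if k ≤ i then [(x, 1)] else []

/-- The word representing the prism over the graph represented by the `k`-uniform word `w`. -/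
def prismWord [DecidableEq V] (k : ℕ) (w : List V) : List (V × Fin 2) :=
  obf (frontBlock k) w ++ obf (backBlock k) w

/-- Makes `List.count` over `V × Fin 2` use the same equality test as in `uniform`. -/
instance instBEqProdFinTwo [DecidableEq V] : BEq (V × Fin 2) := instBEqOfDecidableEq

section Counts

variable [DecidableEq V] {k : ℕ}

theorem count_frontBlock_zero (a z : V) (i : ℕ) :
    (frontBlock k a i).count (z, 0) = if a = z then 1 else 0 := by
  unfold frontBlock
  split_ifs <;> simp_all

theorem count_frontBlock_one (a z : V) (i : ℕ) :
    (frontBlock k a i).count (z, 1) = if a = z ∧ i < k then 1 else 0 := by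
  unfold frontBlock
  split_ifs <;> simp_all

theorem count_backBlock_zero (a z : V) (i : ℕ) :
    (backBlock k a i).count (z, 0) = if a = z ∧ i + 1 = k then 1 else 0 := by
  unfold backBlock
  split_ifs <;> simp_all

theorem count_backBlock_one (a z : V) (i : ℕ) :
    (backBlock k a i).count (z, 1) = if a = z ∧ k ≤ i + 1 then 1 else 0 := by
  unfold backBlock
  by_cases h : a = z
  · subst h
    simp only [true_and]
    split_ifs <;> first | omega | simp
  · split_ifs <;> simp_all

theorem count_concat (w : List V) (a z : V) :
    (w ++ [a]).count z = w.count z + if a = z then 1 else 0 := by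
  simp [List.count_append, List.count_singleton]

theorem count_obf_frontBlock_zero (w : List V) (z : V) :
    (obf (frontBlock k) w).count (z, 0) = w.count z := by
  induction w using List.reverseRecOn with
  | nil => simp [obf_nil]
  | append_singleton w a ih =>
    rw [obf_concat, List.count_append, ih, count_frontBlock_zero, count_concat]

theorem count_obf_frontBlock_one (w : List V) (z : V) :
    (obf (frontBlock k) w).count (z, 1) = min (w.count z) (k - 1) := by
  induction w using List.reverseRecOn with
  | nil => simp [obf_nil]
  | append_singleton w a ih =>
    rw [obf_concat, List.count_append, ih, count_frontBlock_one, count_concat]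
    by_cases h : a = z
    · subst h
      simp only [true_and, if_true]
      split_ifs <;> omega
    · simp [h]

theorem count_obf_backBlock_zero (hk : 1 < k) (w : List V) (z : V) :
    (obf (backBlock k) w).count (z, 0) = min 1 (w.count z - (k - 2)) := by
  induction w using List.reverseRecOn with
  | nil => simp [obf_nil]
  | append_singleton w a ih =>
    rw [obf_concat, List.count_append, ih, count_backBlock_zero, count_concat]
    by_cases h : a = z
    · subst h
      simp only [true_and, if_true]
      split_ifs <;> omega
    · simp [h]

theorem count_obf_backBlock_one (hk : 1 < k) (w : List V) (z : V) :
    (obf (backBlock k) w).count (z, 1) = w.count z - (k - 2) := by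
  induction w using List.reverseRecOn with
  | nil => simp [obf_nil]
  | append_singleton w a ih =>
    rw [obf_concat, List.count_append, ih, count_backBlock_one, count_concat]
    by_cases h : a = z
    · subst h
      simp only [true_and, if_true]
      split_ifs <;> omega
    · simp [h]

end Counts

theorem prefix_pair_cases {a b : V} {q : List V} (h : q <+: [a, b]) :
    q = [] ∨ q = [a] ∨ q = [a, b] := by
  rcases List.prefix_cons_iff.1 h with rfl | ⟨s, rfl, hs⟩
  · simp
  rcases List.prefix_cons_iff.1 hs with rfl | ⟨t, rfl, ht⟩
  · simp
  · simp [List.prefix_nil.1 ht]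

/-- In a prefix of `obf (frontBlock k) w`, the copies `(z, 0)` and `(z, 1)` are counted by
prefixes `q` and `r` of `w` in which the count of each letter differs by at most one. -/
theorem exists_prefix_of_prefix_front [DecidableEq V] {k : ℕ} {w : List V}
    {p : List (V × Fin 2)} (hp : p <+: obf (frontBlock k) w) :
    ∃ q r, q <+: w ∧ r <+: w ∧ ∀ z, r.count z ≤ q.count z ∧ q.count z ≤ r.count z + 1 ∧
      p.count (z, 0) = q.count z ∧ p.count (z, 1) = min (r.count z) (k - 1) := by
  induction w using List.reverseRecOn with
  | nil =>
    rw [obf_nil, List.prefix_nil] at hp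
    exact ⟨[], [], by simp [hp]⟩
  | append_singleton w a ih =>
    have hw : w <+: w ++ [a] := List.prefix_append _ _
    rw [obf_concat] at hp
    rcases prefix_append_cases hp with h | ⟨s, hs, rfl⟩
    · obtain ⟨q, r, hq, hr, h⟩ := ih h
      exact ⟨q, r, hq.trans hw, hr.trans hw, h⟩
    have full : ∀ z, (obf (frontBlock k) w ++ frontBlock k a (w.count a + 1)).count (z, 0) =
          (w ++ [a]).count z ∧
        (obf (frontBlock k) w ++ frontBlock k a (w.count a + 1)).count (z, 1) =
          min ((w ++ [a]).count z) (k - 1) := fun z => by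
      rw [← obf_concat]
      exact ⟨count_obf_frontBlock_zero _ z, count_obf_frontBlock_one _ z⟩
    have cases : s = [] ∨ s = [(a, 0)] ∨ s = frontBlock k a (w.count a + 1) := by
      unfold frontBlock at hs ⊢
      split_ifs at hs ⊢
      · exact prefix_pair_cases hs
      · rcases List.prefix_cons_iff.1 hs with rfl | ⟨q, rfl, hq⟩
        · simp
        · simp [List.prefix_nil.1 hq]
    rcases cases with rfl | rfl | rfl
    · exact ⟨w, w, hw, hw, fun z => ⟨le_rfl, by omega,
        by simp [count_obf_frontBlock_zero], by simp [count_obf_frontBlock_one]⟩⟩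
    · refine ⟨w ++ [a], w, List.prefix_rfl, hw, fun z => ?_⟩
      rw [count_concat, List.count_append, List.count_append, count_obf_frontBlock_zero,
        count_obf_frontBlock_one]
      by_cases h : a = z <;> simp [h]
    · exact ⟨w ++ [a], w ++ [a], List.prefix_rfl, List.prefix_rfl, fun z =>
        ⟨le_rfl, by omega, full z⟩⟩

theorem exists_prefix_of_prefix_back [DecidableEq V] {k : ℕ} (hk : 1 < k) {w : List V}
    {p : List (V × Fin 2)} (hp : p <+: obf (backBlock k) w) :
    ∃ q r, q <+: w ∧ r <+: w ∧ ∀ z, q.count z ≤ r.count z ∧ r.count z ≤ q.count z + 1 ∧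
      p.count (z, 0) = min 1 (q.count z - (k - 2)) ∧ p.count (z, 1) = r.count z - (k - 2) := by
  induction w using List.reverseRecOn with
  | nil =>
    rw [obf_nil, List.prefix_nil] at hp
    exact ⟨[], [], by simp [hp]⟩
  | append_singleton w a ih =>
    have hw : w <+: w ++ [a] := List.prefix_append _ _
    rw [obf_concat] at hp
    rcases prefix_append_cases hp with h | ⟨s, hs, rfl⟩
    · obtain ⟨q, r, hq, hr, h⟩ := ih h
      exact ⟨q, r, hq.trans hw, hr.trans hw, h⟩
    have full : ∀ z, (obf (backBlock k) w ++ backBlock k a (w.count a + 1)).count (z, 0) =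
          min 1 ((w ++ [a]).count z - (k - 2)) ∧
        (obf (backBlock k) w ++ backBlock k a (w.count a + 1)).count (z, 1) =
          (w ++ [a]).count z - (k - 2) := fun z => by
      rw [← obf_concat]
      exact ⟨count_obf_backBlock_zero hk _ z, count_obf_backBlock_one hk _ z⟩
    have cases : s = [] ∨ (s = [(a, 1)] ∧ k ≤ w.count a + 2) ∨
        s = backBlock k a (w.count a + 1) := by
      unfold backBlock at hs ⊢
      split_ifs at hs ⊢ with h1 h2
      · rcases prefix_pair_cases hs with h | h | h
        · exact Or.inl h
        · exact Or.inr (Or.inl ⟨h, by omega⟩)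
        · exact Or.inr (Or.inr h)
      · rcases List.prefix_cons_iff.1 hs with rfl | ⟨q, rfl, hq⟩
        · simp
        · simp [List.prefix_nil.1 hq]
      · exact Or.inl (List.prefix_nil.1 hs)
    rcases cases with rfl | ⟨rfl, hka⟩ | rfl
    · exact ⟨w, w, hw, hw, fun z => ⟨le_rfl, by omega,
        by simp [count_obf_backBlock_zero hk], by simp [count_obf_backBlock_one hk]⟩⟩
    · refine ⟨w, w ++ [a], hw, List.prefix_rfl, fun z => ?_⟩
      rw [count_concat, List.count_append, List.count_append, count_obf_backBlock_zero hk,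
        count_obf_backBlock_one hk]
      by_cases h : a = z
      · subst h
        simp
        omega
      · simp [h]
    · exact ⟨w ++ [a], w ++ [a], List.prefix_rfl, List.prefix_rfl, fun z =>
        ⟨le_rfl, by omega, full z⟩⟩

theorem exists_prefix_concat_of_lt_count [DecidableEq V] {x : V} {n : ℕ} {w : List V}
    (h : n < w.count x) : ∃ q, q ++ [x] <+: w ∧ q.count x = n := by
  induction w using List.reverseRecOn with
  | nil => simp at h
  | append_singleton w a ih =>
    by_cases hn : n < w.count x
    · obtain ⟨q, hq, hc⟩ := ih hn
      exact ⟨q, hq.trans (List.prefix_append _ _), hc⟩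
    · rw [count_concat] at h
      split_ifs at h with hax
      · subst hax
        exact ⟨w, List.prefix_rfl, by omega⟩
      · omega

section Prism

variable [DecidableEq V] {k : ℕ} {w : List V}

theorem uniform_prismWord (hk : 1 < k) (hw : uniform k w) : uniform (k + 1) (prismWord k w) := by
  rintro ⟨x, i⟩
  have := hw x
  fin_cases i
  · simp only [prismWord, List.count_append, Fin.zero_eta, count_obf_frontBlock_zero,
      count_obf_backBlock_zero hk]
    omega
  · simp only [prismWord, List.count_append, Fin.mk_one, count_obf_frontBlock_one,
      count_obf_backBlock_one hk]
    omega

theorem count_le_of_prefix (hw : uniform k w) {q : List V} (hq : q <+: w) (z : V) :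
    q.count z ≤ k := by
  rw [← hw z]
  exact hq.sublist.count_le z

theorem front_prefix_prismWord {q : List V} (hq : q <+: w) :
    obf (frontBlock k) q <+: prismWord k w :=
  (obf_prefix_obf _ hq).trans (List.prefix_append _ _)

theorem back_prefix_prismWord {q : List V} (hq : q <+: w) :
    obf (frontBlock k) w ++ obf (backBlock k) q <+: prismWord k w :=
  (List.prefix_append_right_inj _).2 (obf_prefix_obf _ hq)

theorem leads_prismWord_zero_iff (hk : 1 < k) (hw : uniform k w) (x y : V) :
    Leads (prismWord k w) (x, 0) (y, 0) ↔ Leads w x y := by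
  constructor
  · intro h q hq
    simpa only [count_obf_frontBlock_zero] using h _ (front_prefix_prismWord hq)
  · intro h p hp
    rcases prefix_append_cases hp with hp | ⟨s, hs, rfl⟩
    · obtain ⟨q, r, hq, -, hc⟩ := exists_prefix_of_prefix_front hp
      simpa only [hc] using h q hq
    · obtain ⟨q, r, hq, -, hc⟩ := exists_prefix_of_prefix_back hk hs
      have := h q hq
      have hx := hw x
      have hy := hw y
      simp only [List.count_append, count_obf_frontBlock_zero, hc]
      omega

theorem leads_prismWord_one_iff (hk : 1 < k) (hw : uniform k w) (x y : V) :
    Leads (prismWord k w) (x, 1) (y, 1) ↔ Leads w x y := by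
  have hx := hw x
  have hy := hw y
  constructor
  · intro h q hq
    have h1 := h _ (front_prefix_prismWord hq)
    have h2 := h _ (back_prefix_prismWord hq)
    have hqx := count_le_of_prefix hw hq x
    have hqy := count_le_of_prefix hw hq y
    simp only [List.count_append, count_obf_frontBlock_one, count_obf_backBlock_one hk] at h1 h2
    omega
  · intro h p hp
    rcases prefix_append_cases hp with hp | ⟨s, hs, rfl⟩
    · obtain ⟨q, r, -, hr, hc⟩ := exists_prefix_of_prefix_front hp
      have := h r hr
      simp only [hc]
      omega
    · obtain ⟨q, r, -, hr, hc⟩ := exists_prefix_of_prefix_back hk hs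
      have := h r hr
      simp only [List.count_append, count_obf_frontBlock_one, hc]
      omega

theorem leads_prismWord_zero_one (hk : 1 < k) (hw : uniform k w) (x : V) :
    Leads (prismWord k w) (x, 0) (x, 1) := by
  intro p hp
  have hx := hw x
  rcases prefix_append_cases hp with hp | ⟨s, hs, rfl⟩
  · obtain ⟨q, r, hq, -, hc⟩ := exists_prefix_of_prefix_front hp
    have := count_le_of_prefix hw hq x
    have := hc x
    omega
  · obtain ⟨q, r, -, hr, hc⟩ := exists_prefix_of_prefix_back hk hs
    have := count_le_of_prefix hw hr x
    have := hc x
    simp only [List.count_append, count_obf_frontBlock_zero, count_obf_frontBlock_one]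
    omega

theorem not_leads_prismWord_one_zero (hk : 1 < k) (hw : uniform k w) (x y : V) :
    ¬ Leads (prismWord k w) (y, 1) (x, 0) := by
  intro h
  have := h _ (front_prefix_prismWord List.prefix_rfl)
  rw [count_obf_frontBlock_zero, count_obf_frontBlock_one, hw x, hw y] at this
  omega

theorem not_leads_prismWord_zero_one (hk : 1 < k) (hw : uniform k w) {x y : V} (hxy : x ≠ y) :
    ¬ Leads (prismWord k w) (x, 0) (y, 1) := by
  intro h
  have hx := hw x
  have hy := hw y
  obtain ⟨q, hq, hc⟩ := exists_prefix_concat_of_lt_count (x := x) (n := k - 2) (w := w) (by omega)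
  have h1 := h _ (front_prefix_prismWord ((List.prefix_append q [x]).trans hq))
  have h2 := h _ (back_prefix_prismWord hq)
  simp only [List.count_append, count_obf_frontBlock_zero, count_obf_frontBlock_one,
    count_obf_backBlock_zero hk, count_obf_backBlock_one hk, List.count_singleton_self,
    List.count_singleton, beq_iff_eq, hxy, if_false] at h1 h2
  omega

theorem alternate_prismWord_zero_one_iff (hk : 1 < k) (hw : uniform k w) (x y : V) :
    alternate (prismWord k w) (x, 0) (y, 1) ↔ x = y := by
  rw [alternate_iff_leads (by simp)]
  constructor
  · rintro (h | h)
    · by_contra hxy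
      exact not_leads_prismWord_zero_one hk hw hxy h
    · exact absurd h (not_leads_prismWord_one_zero hk hw x y)
  · rintro rfl
    exact Or.inl (leads_prismWord_zero_one hk hw x)

theorem alternate_comm (l : List V) (x y : V) : alternate l x y ↔ alternate l y x := by
  simp only [alternate, or_comm]

theorem represents_prismWord (G : SimpleGraph V) (hk : 1 < k) (hw : uniform k w)
    (hG : represents G w) :
    represents (G □ (⊤ : SimpleGraph (Fin 2))) (prismWord k w) := by
  refine ⟨fun x => List.count_pos_iff.1 (by rw [uniform_prismWord hk hw x]; omega), ?_⟩
  rintro ⟨x, i⟩ ⟨y, j⟩ hne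
  rw [boxProd_adj]
  fin_cases i <;> fin_cases j
  · have hxy : x ≠ y := fun h => hne (by simp [h])
    simp only [Fin.zero_eta] at hne ⊢
    rw [alternate_iff_leads hne, leads_prismWord_zero_iff hk hw, leads_prismWord_zero_iff hk hw,
      ← alternate_iff_leads hxy, hG.2 x y hxy]
    simp
  · simpa using alternate_prismWord_zero_one_iff hk hw x y
  · rw [alternate_comm]
    simpa [eq_comm] using alternate_prismWord_zero_one_iff hk hw y x
  · have hxy : x ≠ y := fun h => hne (by simp [h])
    simp only [Fin.mk_one] at hne ⊢
    rw [alternate_iff_leads hne, leads_prismWord_one_iff hk hw, leads_prismWord_one_iff hk hw,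
      ← alternate_iff_leads hxy, hG.2 x y hxy]
    simp

end Prism

theorem stmt4 {V : Type*} [DecidableEq V] (G : SimpleGraph V) (k : ℕ) (hk : 1 < k)
    (hG : ∃ w : List V, uniform k w ∧ represents G w) :
    ∃ w' : List (V × Fin 2), uniform (k + 1) w' ∧
      represents (G □ (⊤ : SimpleGraph (Fin 2))) w' := by
  obtain ⟨w, hw, hG⟩ := hG
  exact ⟨prismWord k w, uniform_prismWord hk hw, represents_prismWord G hk hw hG⟩
end
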